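/- The discrete Landau–Lifshits Yang–Baxter map satisfies the parametric Yang–Baxter equation: for all α, β ∈ ℂ, all points 𝐚 = (a,A), 𝐛 = (b,B), 𝐜 = (c,C) on the Weierstrass curve E = {(χ,𝒳) ∈ ℂ² : 𝒳² + χ³ + αχ + β = 0} with a, b, c nonzero and pairwise distinct, and all triples of points of ℂ² such that every denominator encountered in evaluating both compositions R^{(2,3)}_{(𝐛,𝐜)} ∘ R^{(1,3)}_{(𝐚,𝐜)} ∘ R^{(1,2)}_{(𝐚,𝐛)} and R^{(1,2)}_{(𝐚,𝐛)} ∘ R^{(1,3)}_{(𝐚,𝐜)} ∘ R^{(2,3)}_{(𝐛,𝐜)} is nonzero, the two compositions give the same value. -/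

import Mathlib

/-- `R` acting on factors (1,2) of `Y³` and as the identity on the third. -/
def act12 {Y : Type*} (R : Y × Y → Y × Y) : Y × Y × Y → Y × Y × Y :=
  fun p => ((R (p.1, p.2.1)).1, (R (p.1, p.2.1)).2, p.2.2)

/-- `R` acting on factors (1,3) of `Y³` and as the identity on the second. -/
def act13 {Y : Type*} (R : Y × Y → Y × Y) : Y × Y × Y → Y × Y × Y :=
  fun p => ((R (p.1, p.2.2)).1, p.2.1, (R (p.1, p.2.2)).2)

/-- `R` acting on factors (2,3) of `Y³` and as the identity on the first. -/
def act23 {Y : Type*} (R : Y × Y → Y × Y) : Y × Y × Y → Y × Y × Y :=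
  fun p => (p.1, (R (p.2.1, p.2.2)).1, (R (p.2.1, p.2.2)).2)

/-- Membership in the Weierstrass curve `E = {(χ,𝒳) : 𝒳² + χ³ + αχ + β = 0}`. -/
def onW (α β : ℂ) (p : ℂ × ℂ) : Prop :=
  p.2 ^ 2 + p.1 ^ 3 + α * p.1 + β = 0

/-- `s_m = B·a^{m−1} + A·b^{m−1}` for `𝐚 = (a,A)`, `𝐛 = (b,B)`. -/
noncomputable def sLL (a b : ℂ × ℂ) (m : ℕ) : ℂ :=
  b.2 * a.1 ^ ((m : ℤ) - 1) + a.2 * b.1 ^ ((m : ℤ) - 1)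

/-- `K(y,z) − N(y,z)`. -/
noncomputable def diffLL (α β : ℂ) (a b : ℂ × ℂ) (y z : ℂ) : ℂ :=
  2 * sLL a b 2 * y * z - (α * sLL a b 1 + sLL a b 3) * (y - z)
    - 2 * α * sLL a b 2 - 4 * β * sLL a b 1

/-- `K(y,z) + N(y,z)`. -/
noncomputable def sumLL (α β : ℂ) (a b : ℂ × ℂ) (y z : ℂ) : ℂ :=
  (y + z) * (a.1 * b.1 * (α * sLL a b 0 + 3 * sLL a b 2)
    + 4 * β * sLL a b 1 + 3 * α * sLL a b 2 + sLL a b 4) / (a.1 - b.1)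

/-- `K(y,z)`. -/
noncomputable def Kll (α β : ℂ) (a b : ℂ × ℂ) (y z : ℂ) : ℂ :=
  (sumLL α β a b y z + diffLL α β a b y z) / 2

/-- `N(y,z)`. -/
noncomputable def Nll (α β : ℂ) (a b : ℂ × ℂ) (y z : ℂ) : ℂ :=
  (sumLL α β a b y z - diffLL α β a b y z) / 2

/-- `L(y,z)`. -/
noncomputable def Lll (α β : ℂ) (a b : ℂ × ℂ) (y z : ℂ) : ℂ :=
  sLL a b 3 * y * z + (α * sLL a b 2 + 2 * β * sLL a b 1) * (y - z)
    + 4 * β * sLL a b 2 - α ^ 2 * sLL a b 1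

/-- `M(y,z)`. -/
noncomputable def Mll (α β : ℂ) (a b : ℂ × ℂ) (y z : ℂ) : ℂ :=
  sLL a b 1 * y * z + sLL a b 2 * (y - z) - sLL a b 3

/-- `F₁(x,y,z;𝐚,𝐛) = (K(y,z)x − L(y,z))/(M(y,z)x + N(y,z))`. -/
noncomputable def F1ll (α β : ℂ) (a b : ℂ × ℂ) (x y z : ℂ) : ℂ :=
  (Kll α β a b y z * x - Lll α β a b y z) / (Mll α β a b y z * x + Nll α β a b y z)

/-- `F₂(x,y,z;𝐚,𝐛) = (K(y,z)x + L(y,z))/(−M(y,z)x + N(y,z))`. -/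
noncomputable def F2ll (α β : ℂ) (a b : ℂ × ℂ) (x y z : ℂ) : ℂ :=
  (Kll α β a b y z * x + Lll α β a b y z) / (-(Mll α β a b y z) * x + Nll α β a b y z)

/-- The discrete Landau–Lifshits Yang–Baxter map
`R_{(𝐚,𝐛)}((x,X),(y,Y)) = ((F₁(y,x,Y;𝐚,𝐛), Y), (x, F₂(X,x,Y;𝐚,𝐛)))`. -/
noncomputable def Rll (α β : ℂ) (a b : ℂ × ℂ) :
    (ℂ × ℂ) × (ℂ × ℂ) → (ℂ × ℂ) × (ℂ × ℂ) :=
  fun uv => ((F1ll α β a b uv.2.1 uv.1.1 uv.2.2, uv.2.2),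
             (uv.1.1, F2ll α β a b uv.1.2 uv.1.1 uv.2.2))

/-- The denominators encountered in applying `Rll α β a b` at a point are nonzero. -/
def okLL (α β : ℂ) (a b : ℂ × ℂ) (uv : (ℂ × ℂ) × (ℂ × ℂ)) : Prop :=
  Mll α β a b uv.1.1 uv.2.2 * uv.2.1 + Nll α β a b uv.1.1 uv.2.2 ≠ 0 ∧
  -(Mll α β a b uv.1.1 uv.2.2) * uv.1.2 + Nll α β a b uv.1.1 uv.2.2 ≠ 0

/-- The quad polynomial attached to a line meeting the curve in points over `e, f, g`. -/
def Qc (α β l m e f g x X y Z : ℂ) : ℂ :=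
  -l * x * X * y * Z - m * (x * X * y + x * X * Z + x * y * Z + X * y * Z)
    + (l * f * g + m * (f + g)) * (x * Z + X * y) + (l * e * g + m * (e + g)) * (X * Z + x * y)
    + (l * e * f + m * (e + f)) * (y * Z + x * X)
    + (2 * β * l - α * m) * (x + X + y + Z) - 4 * β * m - α ^ 2 * l

/-- The line `X = l x + m` meets the curve over `e, f, g`. -/
def Lin (α β l m e f g : ℂ) : Prop :=
  e + f + g = -l ^ 2 ∧ e * f + e * g + f * g = α + 2 * l * m ∧ e * f * g = -(β + m ^ 2)

/-- Leg function. -/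
def Ng (Z ζ e E x : ℂ) : ℂ := (Z - e) ^ 2 * (x + Z + e) + (ζ - E) ^ 2

/-- Edge biquadratic. -/
def hq (α β d x y : ℂ) : ℂ :=
  (x * y + d * (x + y) - α) ^ 2 - 4 * (x + y + d) * (d * x * y + β)

/-- `Qc` expanded around the centre. -/
def Qs (l L a b c x X y : ℂ) : ℂ :=
  -L * x * X * y + (l * b * c - L * (b + c)) * (X * y) + (l * a * c - L * (a + c)) * (x * y)
   + (l * a * b - L * (a + b)) * (x * X)
   + (2 * l * (a * b * c) - L * (a * b + a * c + b * c)) * (x + X + y)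
   + (4 * L ^ 3 - 4 * L * (a * b * c) + 4 * L * l ^ 2 * (a * b + a * c + b * c)
     - 4 * L ^ 2 * l * (a + b + c) - l * (a * b + a * c + b * c) ^ 2
     + 4 * l * (a + b + c) * (a * b * c) - 4 * l ^ 3 * (a * b * c))

lemma Qc_eq_Qs {α β l m e f g : ℂ} (h : Lin α β l m e f g) (x X y Z : ℂ) :
    Qc α β l m e f g x X y Z
      = Qs l (l * Z + m) (Z - e) (Z - f) (Z - g) (x - Z) (X - Z) (y - Z) := by
  obtain ⟨h1, h2, h3⟩ := h
  obtain rfl : α = e * f + e * g + f * g - 2 * l * m := by linear_combination -h2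
  obtain rfl : β = -(e * f * g) - m ^ 2 := by linear_combination h3
  obtain rfl : g = -l ^ 2 - e - f := by linear_combination h1
  unfold Qc Qs
  ring

lemma threeleg_s (l L a b c x X y ζ : ℂ) (hζ : a * b * c = L ^ 2 - ζ ^ 2) :
    (ζ + L) ^ 2 * ((a ^ 2 * (x + b + c) + 2 * (ζ - L) * l * a + (ζ - L) ^ 2) *
       (b ^ 2 * (X + a + c) + 2 * (ζ - L) * l * b + (ζ - L) ^ 2) *
       (c ^ 2 * (y + a + b) + 2 * (ζ - L) * l * c + (ζ - L) ^ 2))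
    - (ζ - L) ^ 2 * ((a ^ 2 * (x + b + c) - 2 * (ζ + L) * l * a + (ζ + L) ^ 2) *
       (b ^ 2 * (X + a + c) - 2 * (ζ + L) * l * b + (ζ + L) ^ 2) *
       (c ^ 2 * (y + a + b) - 2 * (ζ + L) * l * c + (ζ + L) ^ 2))
    = -4 * ζ * (a * b * c) ^ 2 * Qs l L a b c x X y := by
  have key : ∀ U V W E F G : ℂ,
      (ζ + L) ^ 2 * ((U - 2 * ζ * E) * (V - 2 * ζ * F) * (W - 2 * ζ * G))
      - (ζ - L) ^ 2 * ((U + 2 * ζ * E) * (V + 2 * ζ * F) * (W + 2 * ζ * G))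
      = 4 * ζ * (L * (U * V * W + 4 * ζ ^ 2 * (U * F * G + V * E * G + W * E * F))
        - (ζ ^ 2 + L ^ 2) * (U * V * G + U * W * F + V * W * E + 4 * ζ ^ 2 * (E * F * G))) := by
    intros; ring
  have hD : ζ ^ 2 = L ^ 2 - a * b * c := by linear_combination hζ
  have u1 : ∀ a s l : ℂ, a ^ 2 * s + 2 * (ζ - L) * l * a + (ζ - L) ^ 2
      = (a ^ 2 * s + ζ ^ 2 + L ^ 2 - 2 * L * l * a) - 2 * ζ * (L - l * a) := by intros; ring
  have u2 : ∀ a s l : ℂ, a ^ 2 * s - 2 * (ζ + L) * l * a + (ζ + L) ^ 2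
      = (a ^ 2 * s + ζ ^ 2 + L ^ 2 - 2 * L * l * a) + 2 * ζ * (L - l * a) := by intros; ring
  rw [u1, u1, u1, u2, u2, u2, key, hD]
  rw [show ∀ t, -4 * ζ * (a * b * c) ^ 2 * t = 4 * ζ * (-((a * b * c) ^ 2 * t)) by intro t; ring]
  congr 1
  unfold Qs
  ring

lemma threeleg {α β l m e f g : ℂ} (h : Lin α β l m e f g) (x X y Z ζ : ℂ)
    (hζ : ζ ^ 2 = -(Z ^ 3 + α * Z + β)) :
    (ζ + (l * Z + m)) ^ 2 * (Ng Z ζ e (l * e + m) x * Ng Z ζ f (l * f + m) X * Ng Z ζ g (l * g + m) y)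
    - (ζ - (l * Z + m)) ^ 2 *
      (Ng Z ζ e (-(l * e + m)) x * Ng Z ζ f (-(l * f + m)) X * Ng Z ζ g (-(l * g + m)) y)
    = -4 * ζ * ((Z - e) * (Z - f) * (Z - g)) ^ 2 * Qc α β l m e f g x X y Z := by
  rw [Qc_eq_Qs h, ← threeleg_s]
  · obtain ⟨h1, h2, h3⟩ := h
    have e1 : ∀ e f g x, e + f + g = -l ^ 2 → Ng Z ζ e (l * e + m) x = (Z - e) ^ 2 * (x - Z + (Z - f) + (Z - g))
        + 2 * (ζ - (l * Z + m)) * l * (Z - e) + (ζ - (l * Z + m)) ^ 2 := by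
      intro e f g x h1
      unfold Ng
      linear_combination (Z-e)^2 * h1
    have e2 : ∀ e f g x, e + f + g = -l ^ 2 → Ng Z ζ e (-(l * e + m)) x = (Z - e) ^ 2 * (x - Z + (Z - f) + (Z - g))
        - 2 * (ζ + (l * Z + m)) * l * (Z - e) + (ζ + (l * Z + m)) ^ 2 := by
      intro e f g x h1
      unfold Ng
      linear_combination (Z-e)^2 * h1
    rw [e1 e f g x h1, e1 f e g X (by rw [← h1]; ring), e1 g e f y (by rw [← h1]; ring),
      e2 e f g x h1, e2 f e g X (by rw [← h1]; ring), e2 g e f y (by rw [← h1]; ring)]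
  · obtain ⟨h1, h2, h3⟩ := h
    linear_combination (-Z^2)*h1 + Z*h2 - h3 + hζ

lemma Ng_mul {α β : ℂ} (s S z Z ζ : ℂ) (hζ : ζ ^ 2 = -(Z ^ 3 + α * Z + β))
    (hS : S ^ 2 = -(s ^ 3 + α * s + β)) :
    Ng Z ζ s S z * Ng Z ζ s (-S) z = (Z - s) ^ 2 * hq α β s z Z := by
  have : Ng Z ζ s S z * Ng Z ζ s (-S) z = ((Z - s) ^ 2 * (z + Z + s) + ζ ^ 2 + S ^ 2) ^ 2 - 4 * ζ ^ 2 * S ^ 2 := by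
    unfold Ng; ring
  rw [this, hζ, hS]
  unfold hq
  ring

lemma cross_abs (β b0 b1 γ g0 g1 p p' r r' t t' : ℂ) (Q1 Q3 : ℂ → ℂ) (Q2 : ℂ → ℂ → ℂ)
    (c1 c2 c3 dB dG : ℂ) (hB : b1 - b0 = dB) (hG : g1 - g0 = dG)
    (h1 : ∀ X, c1 * Q1 X = p * (β * X + b0) - p' * (β * X + b1))
    (h2 : ∀ x X, c2 * Q2 x X = r * (β * x + b1) * (γ * X + g0) - r' * (β * x + b0) * (γ * X + g1))
    (h3 : ∀ X, c3 * Q3 X = t * (γ * X + g0) - t' * (γ * X + g1)) :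
    c1 * c2 * c3 *
      ((-Q1 0 * (Q2 1 1 - Q2 1 0 - Q2 0 1 + Q2 0 0) + (Q1 1 - Q1 0) * (Q2 0 1 - Q2 0 0)) * Q3 0
       - (-Q1 0 * (Q2 1 0 - Q2 0 0) + (Q1 1 - Q1 0) * Q2 0 0) * (Q3 1 - Q3 0))
    = -(β * γ * dB * dG * (p * r * t' - p' * r' * t)) := by
  have e : c1 * c2 * c3 *
      ((-Q1 0 * (Q2 1 1 - Q2 1 0 - Q2 0 1 + Q2 0 0) + (Q1 1 - Q1 0) * (Q2 0 1 - Q2 0 0)) * Q3 0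
       - (-Q1 0 * (Q2 1 0 - Q2 0 0) + (Q1 1 - Q1 0) * Q2 0 0) * (Q3 1 - Q3 0))
    = ((-(c1 * Q1 0) * (c2 * Q2 1 1 - c2 * Q2 1 0 - c2 * Q2 0 1 + c2 * Q2 0 0)
        + (c1 * Q1 1 - c1 * Q1 0) * (c2 * Q2 0 1 - c2 * Q2 0 0)) * (c3 * Q3 0)
       - (-(c1 * Q1 0) * (c2 * Q2 1 0 - c2 * Q2 0 0) + (c1 * Q1 1 - c1 * Q1 0) * (c2 * Q2 0 0))
         * (c3 * Q3 1 - c3 * Q3 0)) := by ring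
  rw [e, ← hB, ← hG]
  simp only [h1, h2, h3]
  ring

/-- Cross product of the two-step and one-step images. -/
def crs (Q1 Q3 : ℂ → ℂ) (Q2 : ℂ → ℂ → ℂ) : ℂ :=
  (-Q1 0 * (Q2 1 1 - Q2 1 0 - Q2 0 1 + Q2 0 0) + (Q1 1 - Q1 0) * (Q2 0 1 - Q2 0 0)) * Q3 0
       - (-Q1 0 * (Q2 1 0 - Q2 0 0) + (Q1 1 - Q1 0) * Q2 0 0) * (Q3 1 - Q3 0)

lemma Lin.fac {α β l m e f g : ℂ} (h : Lin α β l m e f g) (Z ζ : ℂ)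
    (hζ : ζ ^ 2 = -(Z ^ 3 + α * Z + β)) :
    (ζ + (l * Z + m)) * (ζ - (l * Z + m)) = -((Z - e) * (Z - f) * (Z - g)) := by
  obtain ⟨h1, h2, h3⟩ := h
  linear_combination (-Z^2)*h1 + Z*h2 - h3 + hζ

lemma Lin.val {α β l m e f g : ℂ} (h : Lin α β l m e f g) :
    (l * e + m) ^ 2 = -(e ^ 3 + α * e + β) := by
  obtain ⟨h1, h2, h3⟩ := h
  linear_combination e^2*h1 - e*h2 + h3

lemma star_alg {ζ s v w d1 d2 d3 τ1 τ2 τ3 τ4 σ1 σ2 σ3 σ4 a1 a2 b1 b2 c1 c2 e1 e2 Q4 cr hh : ℂ}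
    (V W : ℂ) (hζ0 : ζ ≠ 0)
    (ns : s ≠ 0) (nv : v ≠ 0) (nw : w ≠ 0) (n1 : d1 ≠ 0) (n2 : d2 ≠ 0) (n3 : d3 ≠ 0)
    (hX : τ1 * τ2 * σ3 * σ4 = σ1 * σ2 * τ3 * τ4)
    (F1 : τ1 * σ1 = -(s * v * d1)) (F2 : τ2 * σ2 = -(v * w * d2)) (F3 : τ3 * σ3 = -(s * w * d3))
    (F4 : τ4 * σ4 = -(d1 * d2 * d3)) (H : a1 * a2 = s ^ 2 * hh)
    (T4 : -4 * ζ * (d1 * d2 * d3) ^ 2 * Q4 = τ4 ^ 2 * (b1 * c1 * e2) - σ4 ^ 2 * (b2 * c2 * e1))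
    (C : -64 * ζ ^ 3 * ((s * v * w) ^ 4 * (d1 * d2 * d3) ^ 2) * cr
      = -(16 * ζ ^ 2 * v ^ 2 * w ^ 2 * V * W * (a1 * a2) *
        (τ1 ^ 2 * τ2 ^ 2 * σ3 ^ 2 * (b1 * c1 * e2) - σ1 ^ 2 * σ2 ^ 2 * τ3 ^ 2 * (b2 * c2 * e1)))) :
    cr = -(V * W * Q4 * hh) := by
  have X2 : (τ1 * τ2 * σ3 * σ4) ^ 2 = (s * v * w * d1 * d2 * d3) ^ 2 := by
    calc (τ1 * τ2 * σ3 * σ4) ^ 2 = (τ1 * τ2 * σ3 * σ4) * (σ1 * σ2 * τ3 * τ4) := by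
          rw [← hX]; ring
      _ = (τ1 * σ1) * (τ2 * σ2) * (τ3 * σ3) * (τ4 * σ4) := by ring
      _ = _ := by rw [F1, F2, F3, F4]; ring
  have X2' : (σ1 * σ2 * τ3 * τ4) ^ 2 = (s * v * w * d1 * d2 * d3) ^ 2 := by
    rw [← hX, X2]
  have K : (τ1 ^ 2 * τ2 ^ 2 * σ3 ^ 2 * (b1 * c1 * e2) - σ1 ^ 2 * σ2 ^ 2 * τ3 ^ 2 * (b2 * c2 * e1))
      * (τ4 * σ4) ^ 2 = (s * v * w * d1 * d2 * d3) ^ 2 * (-4 * ζ * (d1 * d2 * d3) ^ 2 * Q4) := by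
    rw [T4]
    linear_combination (τ4 ^ 2 * b1 * c1 * e2) * X2 - (σ4 ^ 2 * b2 * c2 * e1) * X2'
  rw [F4] at K
  have nd : (d1 * d2 * d3) ^ 2 ≠ 0 := by positivity
  have K' : (τ1 ^ 2 * τ2 ^ 2 * σ3 ^ 2 * (b1 * c1 * e2) - σ1 ^ 2 * σ2 ^ 2 * τ3 ^ 2 * (b2 * c2 * e1))
       = (s * v * w * d1 * d2 * d3) ^ 2 * (-4 * ζ * Q4) := by
    apply mul_right_cancel₀ nd
    linear_combination K
  rw [K', H] at C
  have nn : -64 * ζ ^ 3 * ((s * v * w) ^ 4 * (d1 * d2 * d3) ^ 2) ≠ 0 := by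
    have : (-64 : ℂ) ≠ 0 := by norm_num
    positivity
  apply mul_left_cancel₀ nn
  rw [C]
  ring

lemma Ng_lin {Z ζ : ℂ} (v : ℂ) (V X : ℂ) :
    Ng Z ζ v V X = (Z - v) ^ 2 * X + ((Z - v) ^ 2 * (Z + v) + (ζ - V) ^ 2) := by
  unfold Ng
  ring

lemma star_gen {α β l1 m1 l2 m2 l3 m3 l4 m4 s v w d1 d2 d3 : ℂ}
    (L1 : Lin α β l1 m1 s v d1) (L2 : Lin α β l2 m2 v w d2)
    (L3 : Lin α β l3 m3 s w d3) (L4 : Lin α β l4 m4 d1 d2 d3)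
    (hs : l1 * s + m1 = l3 * s + m3) (hv : l2 * v + m2 = -(l1 * v + m1))
    (hw : l2 * w + m2 = l3 * w + m3) (hd1 : l1 * d1 + m1 = l4 * d1 + m4)
    (hd2 : l2 * d2 + m2 = l4 * d2 + m4) (hd3 : l4 * d3 + m4 = -(l3 * d3 + m3))
    (z y1 y2 y3 Z ζ : ℂ) (hζ : ζ ^ 2 = -(Z ^ 3 + α * Z + β)) (hζ0 : ζ ≠ 0)
    (hX : (ζ + (l1 * Z + m1)) * (ζ + (l2 * Z + m2)) * (ζ - (l3 * Z + m3)) * (ζ - (l4 * Z + m4))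
      = (ζ - (l1 * Z + m1)) * (ζ - (l2 * Z + m2)) * (ζ + (l3 * Z + m3)) * (ζ + (l4 * Z + m4)))
    (ns : Z - s ≠ 0) (nv : Z - v ≠ 0) (nw : Z - w ≠ 0) (n1 : Z - d1 ≠ 0) (n2 : Z - d2 ≠ 0)
    (n3 : Z - d3 ≠ 0) :
    crs (fun X => Qc α β l1 m1 s v d1 z X y1 Z) (fun X => Qc α β l3 m3 s w d3 z X y3 Z)
      (fun x X => Qc α β l2 m2 v w d2 x X y2 Z)
    = -((l1 * v + m1) * (l3 * w + m3) * Qc α β l4 m4 d1 d2 d3 y1 y2 y3 Z * hq α β s z Z) := by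
  have T1 := fun X => threeleg L1 z X y1 Z ζ hζ
  have T2 := fun x X => threeleg L2 x X y2 Z ζ hζ
  have T3 := fun X => threeleg L3 z X y3 Z ζ hζ
  have T4 := threeleg L4 y1 y2 y3 Z ζ hζ
  have F1 := L1.fac Z ζ hζ
  have F2 := L2.fac Z ζ hζ
  have F3 := L3.fac Z ζ hζ
  have F4 := L4.fac Z ζ hζ
  have H := Ng_mul s (l1 * s + m1) z Z ζ hζ L1.val
  simp only [hv, hw, hd2, neg_neg] at T2
  simp only [hd1] at T1
  simp only [← hs] at T3
  simp only [hd3, neg_neg] at T4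
  generalize hτ1 : ζ + (l1 * Z + m1) = τ1 at *
  generalize hτ2 : ζ + (l2 * Z + m2) = τ2 at *
  generalize hτ3 : ζ + (l3 * Z + m3) = τ3 at *
  generalize hτ4 : ζ + (l4 * Z + m4) = τ4 at *
  generalize hσ1 : ζ - (l1 * Z + m1) = σ1 at *
  generalize hσ2 : ζ - (l2 * Z + m2) = σ2 at *
  generalize hσ3 : ζ - (l3 * Z + m3) = σ3 at *
  generalize hσ4 : ζ - (l4 * Z + m4) = σ4 at *
  have g1 : ∀ X, -4 * ζ * ((Z - s) * (Z - v) * (Z - d1)) ^ 2 * Qc α β l1 m1 s v d1 z X y1 Z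
      = τ1 ^ 2 * (Ng Z ζ s (l1 * s + m1) z * Ng Z ζ d1 (l4 * d1 + m4) y1) *
        ((Z - v) ^ 2 * X + ((Z - v) ^ 2 * (Z + v) + (ζ - (l1 * v + m1)) ^ 2))
        - σ1 ^ 2 * (Ng Z ζ s (-(l1 * s + m1)) z * Ng Z ζ d1 (-(l4 * d1 + m4)) y1) *
        ((Z - v) ^ 2 * X + ((Z - v) ^ 2 * (Z + v) + (ζ + (l1 * v + m1)) ^ 2)) := by
    intro X
    rw [← T1 X, Ng_lin v, Ng_lin v, sub_neg_eq_add]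
    ring
  have g3 : ∀ X, -4 * ζ * ((Z - s) * (Z - w) * (Z - d3)) ^ 2 * Qc α β l3 m3 s w d3 z X y3 Z
      = τ3 ^ 2 * (Ng Z ζ s (l1 * s + m1) z * Ng Z ζ d3 (l3 * d3 + m3) y3) *
        ((Z - w) ^ 2 * X + ((Z - w) ^ 2 * (Z + w) + (ζ - (l3 * w + m3)) ^ 2))
        - σ3 ^ 2 * (Ng Z ζ s (-(l1 * s + m1)) z * Ng Z ζ d3 (-(l3 * d3 + m3)) y3) *
        ((Z - w) ^ 2 * X + ((Z - w) ^ 2 * (Z + w) + (ζ + (l3 * w + m3)) ^ 2)) := by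
    intro X
    rw [← T3 X, Ng_lin w, Ng_lin w, sub_neg_eq_add]
    ring
  have g2 : ∀ x X, -4 * ζ * ((Z - v) * (Z - w) * (Z - d2)) ^ 2 * Qc α β l2 m2 v w d2 x X y2 Z
      = τ2 ^ 2 * Ng Z ζ d2 (l4 * d2 + m4) y2 *
        ((Z - v) ^ 2 * x + ((Z - v) ^ 2 * (Z + v) + (ζ + (l1 * v + m1)) ^ 2)) *
        ((Z - w) ^ 2 * X + ((Z - w) ^ 2 * (Z + w) + (ζ - (l3 * w + m3)) ^ 2))
        - σ2 ^ 2 * Ng Z ζ d2 (-(l4 * d2 + m4)) y2 *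
        ((Z - v) ^ 2 * x + ((Z - v) ^ 2 * (Z + v) + (ζ - (l1 * v + m1)) ^ 2)) *
        ((Z - w) ^ 2 * X + ((Z - w) ^ 2 * (Z + w) + (ζ + (l3 * w + m3)) ^ 2)) := by
    intro x X
    rw [← T2 x X, Ng_lin v, Ng_lin v, Ng_lin w, Ng_lin w, sub_neg_eq_add, sub_neg_eq_add]
    ring
  have C := cross_abs _ _ _ _ _ _ _ _ _ _ _ _ (fun X => Qc α β l1 m1 s v d1 z X y1 Z)
    (fun X => Qc α β l3 m3 s w d3 z X y3 Z) (fun x X => Qc α β l2 m2 v w d2 x X y2 Z)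
    _ _ _ (4 * ζ * (l1 * v + m1)) (4 * ζ * (l3 * w + m3)) (by ring) (by ring) g1 g2 g3
  change _ * crs (fun X => Qc α β l1 m1 s v d1 z X y1 Z) (fun X => Qc α β l3 m3 s w d3 z X y3 Z)
      (fun x X => Qc α β l2 m2 v w d2 x X y2 Z) = _ at C
  generalize Ng Z ζ s (l1 * s + m1) z = a1 at *
  generalize Ng Z ζ s (-(l1 * s + m1)) z = a2 at *
  generalize Ng Z ζ d1 (l4 * d1 + m4) y1 = b1 at *
  generalize Ng Z ζ d1 (-(l4 * d1 + m4)) y1 = b2 at *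
  generalize Ng Z ζ d2 (l4 * d2 + m4) y2 = c1 at *
  generalize Ng Z ζ d2 (-(l4 * d2 + m4)) y2 = c2 at *
  generalize Ng Z ζ d3 (l3 * d3 + m3) y3 = e1 at *
  generalize Ng Z ζ d3 (-(l3 * d3 + m3)) y3 = e2 at *
  generalize hQ4 : Qc α β l4 m4 d1 d2 d3 y1 y2 y3 Z = Q4 at *
  generalize crs _ _ _ = cr at *
  generalize hq α β s z Z = hh at *
  refine star_alg (l1 * v + m1) (l3 * w + m3) hζ0 ns nv nw n1 n2 n3 hX F1 F2 F3 F4 H T4.symm ?_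
  clear T1 T2 T3 T4 H F1 F2 F3 F4 hX
  generalize Z - s = zs at *
  generalize Z - v = zv at *
  generalize Z - w = zw at *
  generalize Z - d1 = z1 at *
  generalize Z - d2 = z2 at *
  generalize Z - d3 = z3 at *
  generalize l1 * v + m1 = V at *
  generalize l3 * w + m3 = W at *
  refine Eq.trans ?_ (C.trans ?_)
  · ring
  · ring

lemma star_all {α β l1 m1 l2 m2 l3 m3 l4 m4 s v w d1 d2 d3 : ℂ}
    (L1 : Lin α β l1 m1 s v d1) (L2 : Lin α β l2 m2 v w d2)
    (L3 : Lin α β l3 m3 s w d3) (L4 : Lin α β l4 m4 d1 d2 d3)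
    (hs : l1 * s + m1 = l3 * s + m3) (hv : l2 * v + m2 = -(l1 * v + m1))
    (hw : l2 * w + m2 = l3 * w + m3) (hd1 : l1 * d1 + m1 = l4 * d1 + m4)
    (hd2 : l2 * d2 + m2 = l4 * d2 + m4) (hd3 : l4 * d3 + m4 = -(l3 * d3 + m3))
    (hX : ∀ Z ζ : ℂ, ζ ^ 2 = -(Z ^ 3 + α * Z + β) →
      (ζ + (l1 * Z + m1)) * (ζ + (l2 * Z + m2)) * (ζ - (l3 * Z + m3)) * (ζ - (l4 * Z + m4))
      = (ζ - (l1 * Z + m1)) * (ζ - (l2 * Z + m2)) * (ζ + (l3 * Z + m3)) * (ζ + (l4 * Z + m4)))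
    (z y1 y2 y3 Z : ℂ) :
    crs (fun X => Qc α β l1 m1 s v d1 z X y1 Z) (fun X => Qc α β l3 m3 s w d3 z X y3 Z)
      (fun x X => Qc α β l2 m2 v w d2 x X y2 Z)
    = -((l1 * v + m1) * (l3 * w + m3) * Qc α β l4 m4 d1 d2 d3 y1 y2 y3 Z * hq α β s z Z) := by
  have hfin : ({Z : ℂ | Z ^ 3 + α * Z + β = 0} ∪ {s, v, w, d1, d2, d3}).Finite := by
    apply Set.Finite.union
    · have hp : (Polynomial.X ^ 3 + Polynomial.C α * Polynomial.X + Polynomial.C β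
          : Polynomial ℂ) ≠ 0 := by
        intro h
        have := congrArg (fun q => Polynomial.coeff q 3) h
        simp [Polynomial.coeff_X, Polynomial.coeff_C] at this
      refine (Polynomial.finite_setOfPred_isRoot hp).subset ?_
      intro Z hZ
      simpa [Polynomial.IsRoot] using hZ
    · exact Set.toFinite _
  have hd : Dense ({Z : ℂ | Z ^ 3 + α * Z + β = 0} ∪ {s, v, w, d1, d2, d3})ᶜ :=
    hfin.countable.dense_compl ℂ
  have hE := Continuous.ext_on hd
    (f := fun Z => crs (fun X => Qc α β l1 m1 s v d1 z X y1 Z)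
      (fun X => Qc α β l3 m3 s w d3 z X y3 Z) (fun x X => Qc α β l2 m2 v w d2 x X y2 Z))
    (g := fun Z => -((l1 * v + m1) * (l3 * w + m3) * Qc α β l4 m4 d1 d2 d3 y1 y2 y3 Z
      * hq α β s z Z))
    (by unfold crs Qc; fun_prop) (by unfold Qc hq; fun_prop) ?_
  · exact congrFun hE Z
  · intro Z hZ
    simp only [Set.mem_compl_iff, Set.mem_union, Set.mem_ofPred_eq, Set.mem_insert_iff,
      Set.mem_singleton_iff, not_or] at hZ
    obtain ⟨h0, h1, h2, h3, h4, h5, h6⟩ := hZ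
    obtain ⟨ζ, hζ⟩ := IsAlgClosed.exists_pow_nat_eq (-(Z ^ 3 + α * Z + β)) (n := 2) (by norm_num)
    have hζ0 : ζ ≠ 0 := by
      rintro rfl
      apply h0
      linear_combination hζ
    exact star_gen L1 L2 L3 L4 hs hv hw hd1 hd2 hd3 z y1 y2 y3 Z ζ hζ hζ0 (hX Z ζ hζ)
      (sub_ne_zero.2 h1) (sub_ne_zero.2 h2) (sub_ne_zero.2 h3) (sub_ne_zero.2 h4)
      (sub_ne_zero.2 h5) (sub_ne_zero.2 h6)

/-- Root of an affine function. -/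
noncomputable def st (Q : ℂ → ℂ) : ℂ := -Q 0 / (Q 1 - Q 0)

lemma crs_eq {Q1 Q3 : ℂ → ℂ} {Q2 : ℂ → ℂ → ℂ} (h : crs Q1 Q3 Q2 = 0)
    (hQ : ∀ u X, Q2 u X = Q2 0 X + u * (Q2 1 X - Q2 0 X)) (n1 : Q1 1 - Q1 0 ≠ 0) :
    (Q2 (st Q1) 1 - Q2 (st Q1) 0) * Q3 0 = Q2 (st Q1) 0 * (Q3 1 - Q3 0) := by
  have hu : (Q1 1 - Q1 0) * st Q1 = -Q1 0 := by unfold st; field_simp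
  rw [hQ (st Q1) 1, hQ (st Q1) 0]
  unfold crs at h
  apply mul_left_cancel₀ n1
  generalize st Q1 = u at *
  linear_combination h + ((Q2 1 1 - Q2 1 0 - Q2 0 1 + Q2 0 0) * Q3 0
    - (Q2 1 0 - Q2 0 0) * (Q3 1 - Q3 0)) * hu

lemma crs_st {Q1 Q3 : ℂ → ℂ} {Q2 : ℂ → ℂ → ℂ} (h : crs Q1 Q3 Q2 = 0)
    (hQ : ∀ u X, Q2 u X = Q2 0 X + u * (Q2 1 X - Q2 0 X)) (n1 : Q1 1 - Q1 0 ≠ 0)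
    (n3 : Q3 1 - Q3 0 ≠ 0) (n2 : Q2 (st Q1) 1 - Q2 (st Q1) 0 ≠ 0) :
    st Q3 = st (Q2 (st Q1)) := by
  have := crs_eq h hQ n1
  unfold st at *
  rw [div_eq_div_iff n3 n2]
  linear_combination -this

lemma crs_root {Q1 Q3 : ℂ → ℂ} {Q2 : ℂ → ℂ → ℂ} (h : crs Q1 Q3 Q2 = 0)
    (hQ : ∀ u X, Q2 u X = Q2 0 X + u * (Q2 1 X - Q2 0 X))
    (hQ' : ∀ u X, Q2 u X = Q2 u 0 + X * (Q2 u 1 - Q2 u 0)) (n1 : Q1 1 - Q1 0 ≠ 0)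
    (n3 : Q3 1 - Q3 0 ≠ 0) :
    Q2 (st Q1) (st Q3) = 0 := by
  have := crs_eq h hQ n1
  have hw : (Q3 1 - Q3 0) * st Q3 = -Q3 0 := by unfold st; field_simp
  rw [hQ']
  apply mul_left_cancel₀ n3
  linear_combination -this + (Q2 (st Q1) 1 - Q2 (st Q1) 0) * hw

lemma st_root {Q : ℂ → ℂ} (hQ : ∀ X, Q X = Q 0 + X * (Q 1 - Q 0)) (n : Q 1 - Q 0 ≠ 0) :
    Q (st Q) = 0 := by
  rw [hQ]
  unfold st
  field_simp
  ring

lemma Qc_swap (α β l m e f g x X y Z : ℂ) :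
    Qc α β l m e f g x X y Z = Qc α β l m f e g x X Z y := by unfold Qc; ring

/-- The configuration of four lines. -/
structure Cfg (α β a b c p q r l1 m1 l2 m2 l3 m3 lT mT : ℂ) : Prop where
  L1 : Lin α β l1 m1 a b p
  L2 : Lin α β l2 m2 b c q
  L3 : Lin α β l3 m3 a c r
  L4 : Lin α β lT mT p q r
  hs : l1 * a + m1 = l3 * a + m3
  hv : l2 * b + m2 = -(l1 * b + m1)
  hw : l2 * c + m2 = l3 * c + m3
  hd1 : l1 * p + m1 = lT * p + mT
  hd2 : l2 * q + m2 = lT * q + mT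
  hd3 : lT * r + mT = -(l3 * r + m3)
  hX : ∀ Z ζ : ℂ, ζ ^ 2 = -(Z ^ 3 + α * Z + β) →
      (ζ + (l1 * Z + m1)) * (ζ + (l2 * Z + m2)) * (ζ - (l3 * Z + m3)) * (ζ - (lT * Z + mT))
      = (ζ - (l1 * Z + m1)) * (ζ - (l2 * Z + m2)) * (ζ + (l3 * Z + m3)) * (ζ + (lT * Z + mT))

lemma Lin.perm1 {α β l m e f g : ℂ} (h : Lin α β l m e f g) : Lin α β l m f e g := by
  obtain ⟨h1, h2, h3⟩ := h
  exact ⟨by rw [← h1]; ring, by rw [← h2]; ring, by rw [← h3]; ring⟩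

lemma Lin.perm2 {α β l m e f g : ℂ} (h : Lin α β l m e f g) : Lin α β l m e g f := by
  obtain ⟨h1, h2, h3⟩ := h
  exact ⟨by rw [← h1]; ring, by rw [← h2]; ring, by rw [← h3]; ring⟩

lemma Lin.ng {α β l m e f g : ℂ} (h : Lin α β l m e f g) : Lin α β (-l) (-m) e f g := by
  obtain ⟨h1, h2, h3⟩ := h
  exact ⟨by rw [h1]; ring, by rw [h2]; ring, by rw [h3]; ring⟩

lemma Cfg.swap {α β a b c p q r l1 m1 l2 m2 l3 m3 lT mT : ℂ}
    (h : Cfg α β a b c p q r l1 m1 l2 m2 l3 m3 lT mT) :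
    Cfg α β c b a q p r l2 m2 l1 m1 l3 m3 lT mT where
  L1 := h.L2.perm1
  L2 := h.L1.perm1
  L3 := h.L3.perm1
  L4 := h.L4.perm1
  hs := h.hw
  hv := by linear_combination h.hv
  hw := h.hs
  hd1 := h.hd2
  hd2 := h.hd1
  hd3 := h.hd3
  hX := fun Z ζ hζ => by linear_combination h.hX Z ζ hζ

section
variable {α β a b c p q r l1 m1 l2 m2 l3 m3 lT mT : ℂ}

lemma Cfg.star4 (h : Cfg α β a b c p q r l1 m1 l2 m2 l3 m3 lT mT) (z y1 y2 y3 Z : ℂ)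
    (hQ : Qc α β lT mT p q r y1 y2 y3 Z = 0) :
    crs (fun X => Qc α β l1 m1 a b p z X y1 Z) (fun X => Qc α β l3 m3 a c r z X y3 Z)
      (fun x X => Qc α β l2 m2 b c q x X y2 Z) = 0 := by
  rw [star_all h.L1 h.L2 h.L3 h.L4 h.hs h.hv h.hw h.hd1 h.hd2 h.hd3 h.hX, hQ]
  ring

lemma Cfg.starT (h : Cfg α β a b c p q r l1 m1 l2 m2 l3 m3 lT mT) (z y1 y2 y3 Z : ℂ)
    (hQ : Qc α β l2 m2 b q c y1 y2 y3 Z = 0) :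
    crs (fun X => Qc α β l1 m1 a p b z X y1 Z) (fun X => Qc α β l3 m3 a r c z X y3 Z)
      (fun x X => Qc α β (-lT) (-mT) p r q x X y2 Z) = 0 := by
  have hQ' : Qc α β (-l2) (-m2) b q c y1 y2 y3 Z = 0 := by
    rw [show Qc α β (-l2) (-m2) b q c y1 y2 y3 Z = -Qc α β l2 m2 b q c y1 y2 y3 Z by
      unfold Qc; ring, hQ, neg_zero]
  rw [star_all h.L1.perm2 h.L4.ng.perm2 h.L3.perm2 h.L2.ng.perm2 h.hs
    (by linear_combination h.hd1) (by linear_combination -h.hd3) (by linear_combination h.hv)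
    (by linear_combination h.hd2) (by linear_combination -h.hw)
    (fun Z ζ hζ => by linear_combination h.hX Z ζ hζ), hQ']
  ring

/-- The closing relation. -/
lemma Cfg.T0 (h : Cfg α β a b c p q r l1 m1 l2 m2 l3 m3 lT mT) {x y Y Z x1 Y1 w : ℂ}
    (n1 : Qc α β l1 m1 b a p y 1 x Y - Qc α β l1 m1 b a p y 0 x Y ≠ 0)
    (hx1 : x1 = st (fun X => Qc α β l1 m1 b a p y X x Y))
    (n2 : Qc α β l2 m2 c b q Y 1 y Z - Qc α β l2 m2 c b q Y 0 y Z ≠ 0)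
    (hY1 : Y1 = st (fun X => Qc α β l2 m2 c b q Y X y Z))
    (n3 : Qc α β l3 m3 c a r y 1 x Y1 - Qc α β l3 m3 c a r y 0 x Y1 ≠ 0)
    (hw : w = st (fun X => Qc α β l3 m3 c a r y X x Y1)) :
    Qc α β lT mT q p r y w x1 Z = 0 := by
  have hQ : Qc α β l2 m2 c b q Y Y1 y Z = 0 := by
    rw [hY1]
    exact st_root (Q := fun X => Qc α β l2 m2 c b q Y X y Z) (fun X => by unfold Qc; ring) n2
  have e1 : ∀ X, Qc α β l1 m1 a p b x X Y y = Qc α β l1 m1 b a p y X x Y := by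
    intro X; unfold Qc; ring
  have e3 : ∀ X, Qc α β l3 m3 a r c x X Y1 y = Qc α β l3 m3 c a r y X x Y1 := by
    intro X; unfold Qc; ring
  have S := h.starT x Y Z Y1 y (by rw [← hQ]; unfold Qc; ring)
  simp only [e1, e3] at S
  have R := crs_root S (fun u X => by unfold Qc; ring) (fun u X => by unfold Qc; ring) n1 n3
  simp only [← hx1, ← hw] at R
  rw [← neg_eq_zero, ← R]
  unfold Qc
  ring

/-- Half of the consistency statement. -/
lemma Cfg.half (h : Cfg α β a b c p q r l1 m1 l2 m2 l3 m3 lT mT) {x1 y w Z z z1 : ℂ}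
    (hT : Qc α β lT mT q p r y w x1 Z = 0)
    (n1 : Qc α β l2 m2 c b q z 1 y Z - Qc α β l2 m2 c b q z 0 y Z ≠ 0)
    (hz1 : z1 = st (fun X => Qc α β l2 m2 c b q z X y Z))
    (n2 : Qc α β l1 m1 b a p z1 1 w Z - Qc α β l1 m1 b a p z1 0 w Z ≠ 0)
    (n3 : Qc α β l3 m3 c a r z 1 x1 Z - Qc α β l3 m3 c a r z 0 x1 Z ≠ 0) :
    st (fun X => Qc α β l3 m3 c a r z X x1 Z) = st (fun X => Qc α β l1 m1 b a p z1 X w Z) := by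
  subst hz1
  exact crs_st (h.swap.star4 z y w x1 Z hT) (fun u X => by unfold Qc; ring) n1 n3 n2

/-- The full consistency statement. -/
lemma Cfg.full (h : Cfg α β a b c p q r l1 m1 l2 m2 l3 m3 lT mT)
    {x X y Y z Z x1 X1 Y1 z1 V w : ℂ}
    (hx1 : x1 = st (fun t => Qc α β l1 m1 b a p y t x Y))
    (hX1 : X1 = st (fun t => Qc α β l1 m1 b a p X t x Y))
    (hY1 : Y1 = st (fun t => Qc α β l2 m2 c b q Y t y Z))
    (hz1 : z1 = st (fun t => Qc α β l2 m2 c b q z t y Z))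
    (hV : V = st (fun t => Qc α β l3 m3 c a r Y t x1 Z))
    (hw : w = st (fun t => Qc α β l3 m3 c a r y t x Y1))
    (nx1 : Qc α β l1 m1 b a p y 1 x Y - Qc α β l1 m1 b a p y 0 x Y ≠ 0)
    (nX1 : Qc α β l1 m1 b a p X 1 x Y - Qc α β l1 m1 b a p X 0 x Y ≠ 0)
    (nY1 : Qc α β l2 m2 c b q Y 1 y Z - Qc α β l2 m2 c b q Y 0 y Z ≠ 0)
    (nz1 : Qc α β l2 m2 c b q z 1 y Z - Qc α β l2 m2 c b q z 0 y Z ≠ 0)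
    (nV : Qc α β l3 m3 c a r Y 1 x1 Z - Qc α β l3 m3 c a r Y 0 x1 Z ≠ 0)
    (nw : Qc α β l3 m3 c a r y 1 x Y1 - Qc α β l3 m3 c a r y 0 x Y1 ≠ 0)
    (k1 : Qc α β l3 m3 c a r z 1 x1 Z - Qc α β l3 m3 c a r z 0 x1 Z ≠ 0)
    (k2 : Qc α β l2 m2 c b q x1 1 x V - Qc α β l2 m2 c b q x1 0 x V ≠ 0)
    (k3 : Qc α β l2 m2 c b q X1 1 x V - Qc α β l2 m2 c b q X1 0 x V ≠ 0)
    (k4 : Qc α β l1 m1 b a p z1 1 w Z - Qc α β l1 m1 b a p z1 0 w Z ≠ 0)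
    (k5 : Qc α β l1 m1 b a p Y1 1 w Z - Qc α β l1 m1 b a p Y1 0 w Z ≠ 0)
    (k6 : Qc α β l3 m3 c a r X 1 x Y1 - Qc α β l3 m3 c a r X 0 x Y1 ≠ 0) :
    st (fun t => Qc α β l3 m3 c a r z t x1 Z) = st (fun t => Qc α β l1 m1 b a p z1 t w Z) ∧
    st (fun t => Qc α β l2 m2 c b q x1 t x V) = w ∧
    V = st (fun t => Qc α β l1 m1 b a p Y1 t w Z) ∧
    st (fun t => Qc α β l2 m2 c b q X1 t x V) = st (fun t => Qc α β l3 m3 c a r X t x Y1) := by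
  have T := h.T0 nx1 hx1 nY1 hY1 nw hw
  refine ⟨h.half T nz1 hz1 k4 k1, ?_, hV.trans (h.half T nY1 hY1 k5 nV), ?_⟩
  all_goals
    simp only [Qc_swap _ _ l1 _ b a, Qc_swap _ _ l2 _ c b, Qc_swap _ _ l3 _ c a] at *
    have T' := h.swap.T0 nY1 hY1 nx1 hx1 nV hV
  · exact (hw.trans (h.swap.half T' nx1 hx1 k2 nw)).symm
  · exact (h.swap.half T' nX1 hX1 k3 k6).symm

end

lemma cfg_mk {α β a b c A B C l1 l2 l3 : ℂ} (ha : A ^ 2 + a ^ 3 + α * a + β = 0)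
    (hb : B ^ 2 + b ^ 3 + α * b + β = 0) (hc : C ^ 2 + c ^ 3 + α * c + β = 0)
    (hab : a ≠ b) (hac : a ≠ c) (hbc : b ≠ c)
    (h1 : l1 * (a - b) = A + B) (h2 : l2 * (b - c) = B + C) (h3 : l3 * (a - c) = A + C) :
    Cfg α β a b c (-l1 ^ 2 - a - b) (-l2 ^ 2 - b - c) (-l3 ^ 2 - a - c)
      l1 (A - l1 * a) l2 (B - l2 * b) l3 (A - l3 * a) (l1 + l2 - l3)
      (l1 * (-l1 ^ 2 - a - b) + (A - l1 * a) - (l1 + l2 - l3) * (-l1 ^ 2 - a - b)) := by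
  have e1 : l1 * (A - B) = -(a ^ 2 + a * b + b ^ 2) - α := by
    apply mul_left_cancel₀ (sub_ne_zero.2 hab)
    linear_combination (A - B) * h1 + ha - hb
  have e3 : l3 * (A - C) = -(a ^ 2 + a * c + c ^ 2) - α := by
    apply mul_left_cancel₀ (sub_ne_zero.2 hac)
    linear_combination (A - C) * h3 + ha - hc
  obtain rfl : A = (l1 * (a - b) + l3 * (a - c) - l2 * (b - c)) / 2 := by
    linear_combination (h2 - h1 - h3) / 2
  obtain rfl : B = (l1 * (a - b) - l3 * (a - c) + l2 * (b - c)) / 2 := by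
    linear_combination -h1
  obtain rfl : C = (-l1 * (a - b) + l3 * (a - c) + l2 * (b - c)) / 2 := by
    linear_combination -h2
  have key : c = l1 * l2 - l1 * l3 - l2 * l3 - a - b := by
    apply mul_left_cancel₀ (sub_ne_zero.2 hbc)
    linear_combination e1 - e3
  obtain rfl : α = -(a ^ 2 + a * b + b ^ 2) - l1 * (l3 * (a - c) - l2 * (b - c)) := by
    linear_combination e1
  obtain rfl := eq_neg_of_add_eq_zero_right ha
  clear e1 e3 ha hb hc h1 h2 h3 hab hac hbc
  subst key
  constructor
  · refine ⟨?_, ?_, ?_⟩ <;> ring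
  · refine ⟨?_, ?_, ?_⟩ <;> ring
  · refine ⟨?_, ?_, ?_⟩ <;> ring
  · refine ⟨?_, ?_, ?_⟩ <;> ring
  · ring
  · ring
  · ring
  · ring
  · ring
  · ring
  · intro Z ζ hζ
    have hodd : ∀ u1 u2 u3 u4 : ℂ, (u1 + u2 - u3 - u4) * ζ ^ 2
        = u1 * u2 * u3 + u1 * u2 * u4 - u1 * u3 * u4 - u2 * u3 * u4 → 
        (ζ + u1) * (ζ + u2) * (ζ - u3) * (ζ - u4) = (ζ - u1) * (ζ - u2) * (ζ + u3) * (ζ + u4) := by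
      intro u1 u2 u3 u4 h
      linear_combination 2 * ζ * h
    apply hodd
    rw [hζ]
    ring

lemma face {α β : ℂ} {a b : ℂ × ℂ} {l : ℂ} (ha : onW α β a) (hb : onW α β b)
    (ha0 : a.1 ≠ 0) (hb0 : b.1 ≠ 0) (hab : a.1 ≠ b.1) (h1 : l * (a.1 - b.1) = a.2 + b.2)
    (x x' y z : ℂ) :
    Mll α β a b y z * x * x' + Nll α β a b y z * x' - Kll α β a b y z * x + Lll α β a b y z
    = (a.1 - b.1) * Qc α β l (a.2 - l * a.1) b.1 a.1 (-l ^ 2 - a.1 - b.1) x x' y (-z) := by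
  obtain ⟨a, A⟩ := a
  obtain ⟨b, B⟩ := b
  simp only [onW] at *
  have s0 : a * b * sLL (a, A) (b, B) 0 = B * b + A * a := by
    simp [sLL]; field_simp
  have s1 : sLL (a, A) (b, B) 1 = B + A := by simp [sLL]
  have s2 : sLL (a, A) (b, B) 2 = B * a + A * b := by simp [sLL]
  have s3 : sLL (a, A) (b, B) 3 = B * a ^ 2 + A * b ^ 2 := by
    simp only [sLL]; norm_num
  have s4 : sLL (a, A) (b, B) 4 = B * a ^ 3 + A * b ^ 3 := by
    simp only [sLL]; norm_num
  have hn := sub_ne_zero.2 hab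
  have e1 : l * (A - B) = -(a ^ 2 + a * b + b ^ 2) - α := by
    apply mul_left_cancel₀ hn
    linear_combination (A - B) * h1 + ha - hb
  obtain rfl : B = l * (a - b) - A := by linear_combination -h1
  obtain rfl : α = -(a ^ 2 + a * b + b ^ 2) - l * (2 * A - l * (a - b)) := by
    linear_combination e1
  obtain rfl := eq_neg_of_add_eq_zero_right ha
  clear ha hb e1 h1
  unfold Kll Nll Mll Lll sumLL diffLL
  rw [show ∀ t u : ℂ, a * b * (t * sLL (a, A) (b, l * (a - b) - A) 0 + u)
    = t * (a * b * sLL (a, A) (b, l * (a - b) - A) 0) + a * b * u by intros; ring]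
  rw [s0, s1, s2, s3, s4]
  unfold Qc
  simp only
  field_simp
  ring

section
variable {α β : ℂ} {a b : ℂ × ℂ} {l : ℂ}

lemma face_den (ha : onW α β a) (hb : onW α β b)
    (ha0 : a.1 ≠ 0) (hb0 : b.1 ≠ 0) (hab : a.1 ≠ b.1) (h1 : l * (a.1 - b.1) = a.2 + b.2)
    (x y z : ℂ) :
    Mll α β a b y z * x + Nll α β a b y z
    = (a.1 - b.1) * (Qc α β l (a.2 - l * a.1) b.1 a.1 (-l ^ 2 - a.1 - b.1) x 1 y (-z)
      - Qc α β l (a.2 - l * a.1) b.1 a.1 (-l ^ 2 - a.1 - b.1) x 0 y (-z)) := by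
  have e1 := face ha hb ha0 hb0 hab h1 x 1 y z
  have e0 := face ha hb ha0 hb0 hab h1 x 0 y z
  linear_combination e1 - e0

lemma face_F1 (ha : onW α β a) (hb : onW α β b)
    (ha0 : a.1 ≠ 0) (hb0 : b.1 ≠ 0) (hab : a.1 ≠ b.1) (h1 : l * (a.1 - b.1) = a.2 + b.2)
    (x y z : ℂ) :
    F1ll α β a b x y z
    = st (fun t => Qc α β l (a.2 - l * a.1) b.1 a.1 (-l ^ 2 - a.1 - b.1) x t y (-z)) := by
  have e0 := face ha hb ha0 hb0 hab h1 x 0 y z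
  have hn := sub_ne_zero.2 hab
  unfold F1ll st
  rw [face_den ha hb ha0 hb0 hab h1, show Kll α β a b y z * x - Lll α β a b y z = (a.1 - b.1) *
    -Qc α β l (a.2 - l * a.1) b.1 a.1 (-l ^ 2 - a.1 - b.1) x 0 y (-z) by
      linear_combination -e0, mul_div_mul_left _ _ hn]

lemma face_F2 (ha : onW α β a) (hb : onW α β b)
    (ha0 : a.1 ≠ 0) (hb0 : b.1 ≠ 0) (hab : a.1 ≠ b.1) (h1 : l * (a.1 - b.1) = a.2 + b.2)
    (x y z : ℂ) :
    -F2ll α β a b x y z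
    = st (fun t => Qc α β l (a.2 - l * a.1) b.1 a.1 (-l ^ 2 - a.1 - b.1) (-x) t y (-z)) := by
  rw [← face_F1 ha hb ha0 hb0 hab h1]
  unfold F2ll F1ll
  rw [← neg_div]
  congr 1 <;> ring

lemma face_ok (ha : onW α β a) (hb : onW α β b)
    (ha0 : a.1 ≠ 0) (hb0 : b.1 ≠ 0) (hab : a.1 ≠ b.1) (h1 : l * (a.1 - b.1) = a.2 + b.2)
    {x X y Y : ℂ} (h : okLL α β a b ((x, X), (y, Y))) :
    (Qc α β l (a.2 - l * a.1) b.1 a.1 (-l ^ 2 - a.1 - b.1) y 1 x (-Y)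
      - Qc α β l (a.2 - l * a.1) b.1 a.1 (-l ^ 2 - a.1 - b.1) y 0 x (-Y) ≠ 0) ∧
    (Qc α β l (a.2 - l * a.1) b.1 a.1 (-l ^ 2 - a.1 - b.1) (-X) 1 x (-Y)
      - Qc α β l (a.2 - l * a.1) b.1 a.1 (-l ^ 2 - a.1 - b.1) (-X) 0 x (-Y) ≠ 0) := by
  obtain ⟨k1, k2⟩ := h
  simp only at k1 k2
  rw [neg_mul, ← mul_neg] at k2
  rw [face_den ha hb ha0 hb0 hab h1] at k1 k2
  exact ⟨right_ne_zero_of_mul k1, right_ne_zero_of_mul k2⟩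

end

/-- The discrete Landau–Lifshits Yang–Baxter map satisfies the parametric
Yang–Baxter equation, for nonzero pairwise-distinct parameters on the Weierstrass
curve, wherever all denominators encountered in both compositions are nonzero. -/
theorem Rll_yangBaxter (α β : ℂ) (a b c : ℂ × ℂ)
    (ha : onW α β a) (hb : onW α β b) (hc : onW α β c)
    (ha0 : a.1 ≠ 0) (hb0 : b.1 ≠ 0) (hc0 : c.1 ≠ 0)
    (hab : a.1 ≠ b.1) (hac : a.1 ≠ c.1) (hbc : b.1 ≠ c.1)
    (u₁ u₂ u₃ : ℂ × ℂ)
    (p1 p2 q1 q2 : (ℂ × ℂ) × (ℂ × ℂ) × (ℂ × ℂ))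
    (hp1 : p1 = act12 (Rll α β a b) (u₁, u₂, u₃))
    (hp2 : p2 = act13 (Rll α β a c) p1)
    (hq1 : q1 = act23 (Rll α β b c) (u₁, u₂, u₃))
    (hq2 : q2 = act13 (Rll α β a c) q1)
    (h1 : okLL α β a b (u₁, u₂))
    (h2 : okLL α β a c (p1.1, p1.2.2))
    (h3 : okLL α β b c (p2.2.1, p2.2.2))
    (h4 : okLL α β b c (u₂, u₃))
    (h5 : okLL α β a c (q1.1, q1.2.2))
    (h6 : okLL α β a b (q2.1, q2.2.1)) :
    act23 (Rll α β b c) p2 = act12 (Rll α β a b) q2 := by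
  obtain ⟨x, X⟩ := u₁
  obtain ⟨y, Y⟩ := u₂
  obtain ⟨z, Z⟩ := u₃
  obtain ⟨l1, e1⟩ : ∃ l, l * (a.1 - b.1) = a.2 + b.2 :=
    ⟨(a.2 + b.2) / (a.1 - b.1), div_mul_cancel₀ _ (sub_ne_zero.2 hab)⟩
  obtain ⟨l2, e2⟩ : ∃ l, l * (b.1 - c.1) = b.2 + c.2 :=
    ⟨(b.2 + c.2) / (b.1 - c.1), div_mul_cancel₀ _ (sub_ne_zero.2 hbc)⟩
  obtain ⟨l3, e3⟩ : ∃ l, l * (a.1 - c.1) = a.2 + c.2 :=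
    ⟨(a.2 + c.2) / (a.1 - c.1), div_mul_cancel₀ _ (sub_ne_zero.2 hac)⟩
  have cfg := cfg_mk ha hb hc hab hac hbc e1 e2 e3
  subst hp1 hp2 hq1 hq2
  simp only [act12, act13, act23, Rll] at h1 h2 h3 h4 h5 h6 ⊢
  have F1ab := face_F1 ha hb ha0 hb0 hab e1
  have F1bc := face_F1 hb hc hb0 hc0 hbc e2
  have F1ac := face_F1 ha hc ha0 hc0 hac e3
  have F2ab := face_F2 ha hb ha0 hb0 hab e1
  have F2bc := face_F2 hb hc hb0 hc0 hbc e2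
  have F2ac := face_F2 ha hc ha0 hc0 hac e3
  obtain ⟨h1a, h1b⟩ := face_ok ha hb ha0 hb0 hab e1 h1
  obtain ⟨h2a, h2b⟩ := face_ok ha hc ha0 hc0 hac e3 h2
  obtain ⟨h3a, h3b⟩ := face_ok hb hc hb0 hc0 hbc e2 h3
  obtain ⟨h4a, h4b⟩ := face_ok hb hc hb0 hc0 hbc e2 h4
  obtain ⟨h5a, h5b⟩ := face_ok ha hc ha0 hc0 hac e3 h5
  obtain ⟨h6a, h6b⟩ := face_ok ha hb ha0 hb0 hab e1 h6
  obtain ⟨R1, R2, R3, R4⟩ := cfg.full (F1ab y x Y) (F2ab X x Y) (F2bc Y y Z) (F1bc z y Z)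
    (F2ac Y (F1ll α β a b y x Y) Z) (F1ac y x (F2ll α β b c Y y Z))
    h1a h1b h4b h4a h2b h5a h2a h3a h3b h6a h6b h5b
  rw [← F1ac, ← F1ab] at R1
  rw [← F1bc] at R2
  rw [← F2ab, neg_inj] at R3
  rw [← F2bc, ← F2ac, neg_inj] at R4
  rw [R1, R2, R4, ← R3]
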